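/- Let G be a finite simple graph that is (P₃ ∪ K₁)-free, has maximum degree Δ(G) ≥ 9 and chromatic number χ(G) > max{ω(G), Δ(G) − 1}, and has the minimum number of vertices among all (P₃ ∪ K₁)-free graphs with these properties. Then ω(G) = Δ(G) − 1. -/

import Mathlib

open SimpleGraph

/-- The graph `H = P₃ ∪ K₁`: a path 0–1–2 together with the isolated vertex 3. -/
def graphH : SimpleGraph (Fin 4) := SimpleGraph.fromEdgeSet {s(0, 1), s(1, 2)}

/-- The graph `R = K₂ ∪ 2K₁`: the edge 0–1 together with the isolated vertices 2 and 3. -/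
def graphR : SimpleGraph (Fin 4) := SimpleGraph.fromEdgeSet {s(0, 1)}

/-- `G` contains no induced subgraph isomorphic to `F`
(graph embeddings are exactly induced-subgraph copies). -/
def IndFree {α : Type*} {V : Type*} (F : SimpleGraph α) (G : SimpleGraph V) : Prop :=
  IsEmpty (F ↪g G)

/-- Maximum degree `Δ(G)` (with classical decidability of adjacency). -/
noncomputable def maxDeg {V : Type*} [Fintype V] (G : SimpleGraph V) : ℕ := by
  classical exact G.maxDegree

/-- Degree of a vertex (with classical decidability of adjacency). -/
noncomputable def deg {V : Type*} [Fintype V] (G : SimpleGraph V) (v : V) : ℕ := by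
  classical exact G.degree v

namespace SimpleGraph

variable {V : Type*} {G : SimpleGraph V} {m : ℕ}

/-- The vertex `v` is alone in its colour class. -/
def IsSolo {α : Type*} (f : V → α) (v : V) : Prop := ∀ w, f w = f v → w = v

/-- Recolour the single vertex `v` with a colour not used on its neighbours. -/
def Coloring.recolor [DecidableEq V] {α : Type*} (C : G.Coloring α) (v : V) (i : α)
    (h : ∀ w, G.Adj v w → C w ≠ i) : G.Coloring α :=
  Coloring.mk (Function.update C v i) (by
    intro a b hab
    have hne := hab.ne
    by_cases ha : a = v
    · subst ha
      rw [Function.update_self, Function.update_of_ne hne.symm]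
      exact (h b hab).symm
    · by_cases hb : b = v
      · subst hb
        rw [Function.update_self, Function.update_of_ne ha]
        exact h a hab.symm
      · rw [Function.update_of_ne ha, Function.update_of_ne hb]
        exact C.valid hab)

lemma Coloring.recolor_apply [DecidableEq V] {α : Type*} (C : G.Coloring α) (v : V) (i : α)
    (h : ∀ w, G.Adj v w → C w ≠ i) (x : V) :
    C.recolor v i h x = if x = v then i else C x := by
  change Function.update C v i x = _
  rw [Function.update_apply]

lemma Coloring.surjective_of_not_colorable (hm : ¬G.Colorable m) (C : G.Coloring (Fin (m + 1))) :
    Function.Surjective C := by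
  intro i
  by_contra hi
  push Not at hi
  apply hm
  let D : G.Coloring {j : Fin (m + 1) // j ≠ i} :=
    Coloring.mk (fun v => ⟨C v, hi v⟩) (fun {a b} hab h => C.valid hab (congrArg Subtype.val h))
  simpa using D.colorable

lemma Coloring.exists_adj_of_isSolo (hm : ¬G.Colorable m) (C : G.Coloring (Fin (m + 1))) {v : V}
    (hv : IsSolo C v) {i : Fin (m + 1)} (hi : i ≠ C v) : ∃ w, G.Adj v w ∧ C w = i := by
  classical
  by_contra! h
  obtain ⟨y, hy⟩ := (C.recolor v i h).surjective_of_not_colorable hm (C v)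
  rw [Coloring.recolor_apply] at hy
  split_ifs at hy with hyv
  · exact hi hy
  · exact hyv (hv y hy)

/-- Two vertices that are each alone in their colour class are adjacent, as otherwise these
classes could be merged. -/
lemma Coloring.adj_of_isSolo (hm : ¬G.Colorable m) (C : G.Coloring (Fin (m + 1))) {u v : V}
    (huv : u ≠ v) (hu : IsSolo C u) (hv : IsSolo C v) : G.Adj u v := by
  obtain ⟨w, hw, h⟩ := C.exists_adj_of_isSolo hm hu (i := C v) fun h => huv (hu v h).symm
  rwa [hv w h] at hw

/-- Every graph that is not `m`-colourable contains a vertex-critical induced subgraph. -/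
lemma exists_critical_induce [Finite V] (hm : ¬G.Colorable m) :
    ∃ s : Set V, ¬(G.induce s).Colorable m ∧
      ∀ v : s, ∃ C : (G.induce s).Coloring (Fin (m + 1)), IsSolo C v := by
  classical
  have huniv : ¬(G.induce (Set.univ : Set V)).Colorable m := fun h =>
    hm (h.of_hom G.induceUnivIso.symm.toHom)
  obtain ⟨s, -, hs⟩ := Finite.exists_le_minimal
    (p := fun s : Set V => ¬(G.induce s).Colorable m) huniv
  refine ⟨s, hs.1, fun v => ?_⟩
  have hcol : (G.induce (s \ {v.1})).Colorable m := by
    by_contra h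
    exact (hs.2 h Set.sdiff_subset v.2).2 rfl
  obtain ⟨C⟩ := hcol
  have hmem (x : s) (h : x ≠ v) : x.1 ∈ s \ {v.1} := ⟨x.2, fun h' => h (Subtype.ext h')⟩
  refine ⟨Coloring.mk (fun x => if h : x = v then Fin.last m
    else (C ⟨x.1, hmem x h⟩).castSucc) ?_, ?_⟩
  · intro a b hab
    have hne := hab.ne
    by_cases ha : a = v
    · have hb : b ≠ v := fun h => hne (ha.trans h.symm)
      simpa [ha, hb] using (Fin.castSucc_ne_last _).symm
    · by_cases hb : b = v
      · simp [ha, hb]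
      · have := C.valid (v := ⟨a.1, hmem a ha⟩) (w := ⟨b.1, hmem b hb⟩) hab
        simpa [ha, hb] using this
  · intro w hw
    by_contra h
    change (if h : w = v then Fin.last m else (C ⟨w.1, hmem w h⟩).castSucc) =
      (if h : v = v then Fin.last m else (C ⟨v.1, hmem v h⟩).castSucc) at hw
    simp [h] at hw

/-- `G` has no induced path `a b c` together with a vertex `d` adjacent to none of them. -/
def NoPathPlusVertex (G : SimpleGraph V) : Prop :=
  ∀ a b c d, G.Adj a b → G.Adj b c → a ≠ c → ¬G.Adj a c → ¬G.Adj d a → ¬G.Adj d b →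
    ¬G.Adj d c → False

lemma noPathPlusVertex_of_indFree (h : IndFree graphH G) : NoPathPlusVertex G := by
  intro a b c d hab hbc hac nac nda ndb ndc
  have hda : d ≠ a := fun e => ndb (e ▸ hab)
  have hdb : d ≠ b := fun e => nda (e ▸ hab.symm)
  have hdc : d ≠ c := fun e => ndb (e ▸ hbc.symm)
  have h1 := hab.ne
  have h2 := hbc.ne
  have h3 := hab.symm
  have h4 := hbc.symm
  have h5 : ¬G.Adj c a := fun e => nac e.symm
  have h6 : ¬G.Adj a d := fun e => nda e.symm
  have h7 : ¬G.Adj b d := fun e => ndb e.symm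
  have h8 : ¬G.Adj c d := fun e => ndc e.symm
  refine h.false ⟨⟨![a, b, c, d], ?_⟩, ?_⟩
  · intro i j hij
    fin_cases i <;> fin_cases j <;> simp_all [eq_comm]
  · intro i j
    change G.Adj (![a, b, c, d] i) (![a, b, c, d] j) ↔ graphH.Adj i j
    fin_cases i <;> fin_cases j <;> simp_all [graphH, eq_comm]

lemma NoPathPlusVertex.induce (h : NoPathPlusVertex G) (s : Set V) :
    NoPathPlusVertex (G.induce s) :=
  fun a b c d hab hbc hac => h a b c d hab hbc fun e => hac (Subtype.ext e)

lemma NoPathPlusVertex.not_indep_triple [Fintype V] (hG : NoPathPlusVertex G)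
    (hm : ¬G.Colorable m) (hcrit : ∀ v, ∃ C : G.Coloring (Fin (m + 1)), IsSolo C v)
    {u v t : V} (huv : u ≠ v) (hut : u ≠ t) (hvt : v ≠ t)
    (nuv : ¬G.Adj u v) (nut : ¬G.Adj u t) (nvt : ¬G.Adj v t) : False := by
  classical
  let P (u v : V) : Finset V := Finset.univ.filter fun x => G.Adj u x ∧ ¬G.Adj v x
  wlog hle : (P u v).card ≤ (P v u).card generalizing u v with key
  · exact key huv.symm hvt hut (fun h => nuv h.symm) nvt nut (le_of_not_ge hle)
  have hP (x) : x ∈ P v u ↔ G.Adj v x ∧ ¬G.Adj u x := by simp [P]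
  have hPt {x} (hx : x ∈ P v u) : ¬G.Adj t x := fun h =>
    hG v x t u ((hP x).1 hx).1 h.symm hvt nvt nuv ((hP x).1 hx).2 nut
  have hclique {x y} (hx : x ∈ insert v (P v u)) (hy : y ∈ insert v (P v u)) (hxy : x ≠ y) :
      G.Adj x y := by
    rw [Finset.mem_insert, hP] at hx hy
    rcases hx with rfl | hx <;> rcases hy with rfl | hy
    · exact absurd rfl hxy
    · exact hy.1
    · exact hx.1.symm
    · by_contra h
      exact hG x v y u hx.1.symm hy.1 hxy h hx.2 nuv hy.2
  have hcommon {z x} (hu : G.Adj u z) (hv : G.Adj v z) (hx : x ∈ insert v (P v u)) :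
      G.Adj z x := by
    rcases Finset.mem_insert.1 hx with rfl | hx
    · exact hv.symm
    · by_contra h
      have htx := hPt hx
      have hx' := (hP x).1 hx
      have htz : G.Adj z t := by
        by_contra h'
        exact hG u z v t hu hv.symm huv nuv (fun e => nut e.symm) (fun e => h' e.symm)
          (fun e => nvt e.symm)
      exact hG u z t x hu htz hut nut (fun e => hx'.2 e.symm) (fun e => h e.symm)
        (fun e => htx e.symm)
  obtain ⟨C, hC⟩ := hcrit u
  have hinj : Set.InjOn C (insert v (P v u) : Finset V) := by
    intro x hx y hy hxy
    by_contra hne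
    exact C.valid (hclique hx hy hne) hxy
  have hcard : ((P u v).image C).card < ((insert v (P v u)).image C).card := by
    rw [Finset.card_image_of_injOn hinj, Finset.card_insert_of_notMem (by simp [P])]
    exact Finset.card_image_le.trans_lt (by omega)
  obtain ⟨i, hi, hi'⟩ := Finset.exists_mem_notMem_of_card_lt_card hcard
  obtain ⟨w, hw, rfl⟩ := Finset.mem_image.1 hi
  have hwu : C w ≠ C u := by
    intro h
    have := hC w h
    subst this
    rcases Finset.mem_insert.1 hw with h | h
    · exact huv h
    · exact nuv ((hP _).1 h).1.symm
  obtain ⟨x, hx, hxw⟩ := C.exists_adj_of_isSolo hm hC hwu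
  by_cases hxv : G.Adj v x
  · exact C.valid (hcommon hx hxv hw) hxw
  · exact hi' (Finset.mem_image.2 ⟨x, by simp [P, hx, hxv], hxw⟩)

/-- `G` has no independent set of three vertices. -/
def NoIndepTriple (G : SimpleGraph V) : Prop :=
  ∀ u v t, u ≠ v → u ≠ t → v ≠ t → ¬G.Adj u v → ¬G.Adj u t → ¬G.Adj v t → False

lemma Coloring.eq_or_eq_of_noIndepTriple (hα : NoIndepTriple G) {α : Type*} (C : G.Coloring α)
    {x y z : V} (hxy : x ≠ y) (h : C x = C y) (hz : C z = C x) : z = x ∨ z = y := by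
  by_contra! hne
  exact hα x y z hxy hne.1.symm hne.2.symm (fun e => C.valid e h) (fun e => C.valid e hz.symm)
    (fun e => C.valid e (h.symm.trans hz.symm))

open Classical in
lemma Coloring.card_add_card_isSolo [Fintype V] (hα : NoIndepTriple G) (hm : ¬G.Colorable m)
    (C : G.Coloring (Fin (m + 1))) :
    Fintype.card V + (Finset.univ.filter (IsSolo C)).card = 2 * (m + 1) := by
  rw [← Finset.card_univ, Finset.card_eq_sum_card_fiberwise (f := C) (t := Finset.univ)
    (fun _ _ => Finset.mem_coe.2 (Finset.mem_univ _)),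
    Finset.card_eq_sum_card_fiberwise (s := Finset.univ.filter (IsSolo C)) (f := C)
    (t := Finset.univ) (fun _ _ => Finset.mem_coe.2 (Finset.mem_univ _)),
    ← Finset.sum_add_distrib]
  have key : ∀ i : Fin (m + 1), (Finset.univ.filter fun x => C x = i).card +
      ((Finset.univ.filter (IsSolo C)).filter fun x => C x = i).card = 2 := by
    intro i
    obtain ⟨x, rfl⟩ := C.surjective_of_not_colorable hm i
    by_cases hx : IsSolo C x
    · have h1 : (Finset.univ.filter fun y => C y = C x) = {x} := by
        ext y
        simpa using ⟨fun h => hx y h, fun h => h ▸ rfl⟩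
      have h2 : ((Finset.univ.filter (IsSolo C)).filter fun y => C y = C x) = {x} := by
        ext y
        simpa using ⟨fun h => hx y h.2, fun h => by subst h; exact ⟨hx, rfl⟩⟩
      rw [h1, h2, Finset.card_singleton]
    · have hx' := hx
      unfold IsSolo at hx'
      push Not at hx'
      obtain ⟨y, hy, hyx⟩ := hx'
      have h1 : (Finset.univ.filter fun z => C z = C x) = {x, y} := by
        ext z
        simp only [Finset.mem_filter, Finset.mem_univ, true_and, Finset.mem_insert,
          Finset.mem_singleton]
        refine ⟨fun h => C.eq_or_eq_of_noIndepTriple hα hyx.symm hy.symm h, ?_⟩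
        rintro (rfl | rfl)
        exacts [rfl, hy]
      have h2 : ((Finset.univ.filter (IsSolo C)).filter fun z => C z = C x) = ∅ := by
        ext z
        simp only [Finset.mem_filter, Finset.mem_univ, true_and, Finset.notMem_empty, iff_false]
        rintro ⟨hz, hzx⟩
        exact hyx ((hz y (hy.trans hzx.symm)).trans (hz x hzx.symm).symm)
      rw [h1, h2, Finset.card_pair hyx.symm, Finset.card_empty]
  rw [Finset.sum_congr rfl fun i _ => key i]
  simp [mul_comm]

/-- No `(m + 1)`-colouring has `u` and `v` as two distinct solo vertices. -/
def Linked (G : SimpleGraph V) (m : ℕ) (u v : V) : Prop :=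
  ∀ C : G.Coloring (Fin (m + 1)), u ≠ v → IsSolo C u → IsSolo C v → False

lemma Linked.symm {u v : V} (h : G.Linked m u v) : G.Linked m v u :=
  fun C hne hv hu => h C hne.symm hu hv

lemma linked_of_not_adj (hm : ¬G.Colorable m) {u v : V} (h : ¬G.Adj u v) : G.Linked m u v :=
  fun C hne hu hv => h (C.adj_of_isSolo hm hne hu hv)

/-- The exchange argument of Gallai's lemma, phrased for colourings with classes of size at most
two. -/
lemma Linked.trans [Fintype V] (hα : NoIndepTriple G) (hm : ¬G.Colorable m)
    (hcrit : ∀ v, ∃ C : G.Coloring (Fin (m + 1)), IsSolo C v)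
    {u t v : V} (hut : G.Linked m u t) (htv : G.Linked m t v) : G.Linked m u v := by
  classical
  intro M huv hMu hMv
  by_cases eut : u = t
  · subst eut
    exact htv M huv hMu hMv
  by_cases etv : t = v
  · subst etv
    exact hut M huv hMu hMv
  let agree (N : G.Coloring (Fin (m + 1))) : Finset (V × V) :=
    Finset.univ.filter fun p => p.1 ≠ p.2 ∧ M p.1 = M p.2 ∧ N p.1 = N p.2
  obtain ⟨N₀, hN₀⟩ := hcrit t
  obtain ⟨N, hNt, hmax⟩ : ∃ N : G.Coloring (Fin (m + 1)), IsSolo N t ∧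
      ∀ N' : G.Coloring (Fin (m + 1)), IsSolo N' t → (agree N').card ≤ (agree N).card := by
    have hbdd : BddAbove ((fun N => (agree N).card) ''
        {N : G.Coloring (Fin (m + 1)) | IsSolo N t}) :=
      ⟨(Finset.univ : Finset (V × V)).card, by
        rintro _ ⟨N, -, rfl⟩
        exact Finset.card_le_card (Finset.subset_univ _)⟩
    obtain ⟨N, hN, h⟩ := Nat.sSup_mem (Set.Nonempty.image _ ⟨N₀, hN₀⟩) hbdd
    exact ⟨N, hN, fun N' hN' => (le_csSup hbdd ⟨N', hN', rfl⟩).trans h.ge⟩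
  have hNu : ¬IsSolo N u := fun h => hut N eut h hNt
  have hNv : ¬IsSolo N v := fun h => htv N etv hNt h
  have hcard := (M.card_add_card_isSolo hα hm).trans (N.card_add_card_isSolo hα hm).symm
  obtain ⟨x, hxt, hNx, hMx⟩ : ∃ x, x ≠ t ∧ IsSolo N x ∧ ¬IsSolo M x := by
    by_contra! h
    have hsub : Finset.univ.filter (IsSolo N) ⊆
        insert t (((Finset.univ.filter (IsSolo M)).erase u).erase v) := by
      intro x hx
      have hx : IsSolo N x := by simpa using hx
      by_cases hxt : x = t
      · simp [hxt]
      · have hxu : x ≠ u := fun e => hNu (e ▸ hx)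
        have hxv : x ≠ v := fun e => hNv (e ▸ hx)
        simp [hxu, hxv, h x hxt hx]
    have h1 := (Finset.card_le_card hsub).trans (Finset.card_insert_le _ _)
    have hu : u ∈ Finset.univ.filter (IsSolo M) := by simpa using hMu
    have hv : v ∈ (Finset.univ.filter (IsSolo M)).erase u := by simpa using ⟨huv.symm, hMv⟩
    have h2 := Finset.card_erase_add_one hu
    have h3 := Finset.card_erase_add_one hv
    omega
  unfold IsSolo at hMx
  push Not at hMx
  obtain ⟨y, hMyx, hyx⟩ := hMx
  have nxy : ¬G.Adj x y := fun e => M.valid e hMyx.symm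
  have hNy : ¬IsSolo N y := fun h => nxy (N.adj_of_isSolo hm hyx.symm hNx h)
  have hyt : t ≠ y := fun e => hNy (e ▸ hNt)
  have hfree : ∀ w, G.Adj y w → N w ≠ N x := by
    intro w hyw hw
    rw [hNx w hw] at hyw
    exact nxy hyw.symm
  let N' := N.recolor y (N x) hfree
  have hN' (z : V) : N' z = if z = y then N x else N z := N.recolor_apply y (N x) hfree z
  have hNxy : N x ≠ N y := fun e => hyx (hNx y e.symm)
  have hNtx : N t ≠ N x := fun e => hxt (hNx t e).symm
  refine absurd (hmax N' ?_) (not_le.2 (Finset.card_lt_card ?_))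
  · intro w hw
    rw [hN', hN', if_neg hyt] at hw
    split_ifs at hw with h
    · exact absurd hw.symm hNtx
    · exact hNt w hw
  · rw [Finset.ssubset_iff_of_subset]
    · refine ⟨(x, y), ?_, ?_⟩
      · simp [agree, hN', hyx.symm, hMyx]
      · simp [agree, hNxy]
    · rintro ⟨a, b⟩ hab
      obtain ⟨hne, hMab, hNab⟩ : a ≠ b ∧ M a = M b ∧ N a = N b := by simpa [agree] using hab
      have hay : a ≠ y := by
        rintro rfl
        rcases M.eq_or_eq_of_noIndepTriple hα hyx hMyx hMab.symm with h | h
        · exact hne h.symm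
        · exact hNxy (h ▸ hNab.symm)
      have hby : b ≠ y := by
        rintro rfl
        rcases M.eq_or_eq_of_noIndepTriple hα hyx hMyx hMab with h | h
        · exact hne h
        · exact hNxy (h ▸ hNab)
      simpa [agree, hN', hay, hby] using ⟨hne, hMab, hNab⟩

/-- The Andrásfai bound for the complement: if every vertex has more than `2n/5` non-neighbours,
then the vertices are covered by two cliques. -/
lemma card_le_of_noIndepTriple_of_lt_degree_compl [Fintype V] [DecidableRel Gᶜ.Adj]
    (hα : NoIndepTriple G) {w : ℕ} (hw : G.CliqueFree (w + 1))
    (hd : ∀ v, 2 * Fintype.card V < 5 * Gᶜ.degree v) : Fintype.card V ≤ 2 * w := by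
  classical
  rcases isEmpty_or_nonempty V with hV | hV
  · simp
  have hfree : Gᶜ.CliqueFree (2 + 1) := by
    intro s hs
    obtain ⟨a, b, c, hab, hac, hbc, -⟩ := is3Clique_iff.1 hs
    rw [compl_adj] at hab hac hbc
    exact hα a b c hab.1 hac.1 hbc.1 hab.2 hac.2 hbc.2
  have hmin : (3 * 2 - 4) * Fintype.card V / (3 * 2 - 1) < Gᶜ.minDegree := by
    obtain ⟨v, hv⟩ := Gᶜ.exists_minimal_degree_vertex
    have := hd v
    omega
  obtain ⟨C⟩ := colorable_of_cliqueFree_lt_minDegree hfree hmin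
  have hclass (i : Fin 2) : (Finset.univ.filter fun v => C v = i).card ≤ w := by
    by_contra! h
    refine hw.mono h _ (⟨?_, rfl⟩)
    intro a ha b hb hab
    by_contra hn
    have ha : C a = i := by simpa using ha
    have hb : C b = i := by simpa using hb
    exact C.valid ((compl_adj _ _ _).2 ⟨hab, hn⟩) (ha.trans hb.symm)
  have := Finset.card_eq_sum_card_fiberwise (s := (Finset.univ : Finset V)) (f := C)
    (t := Finset.univ) (fun _ _ => Finset.mem_coe.2 (Finset.mem_univ _))
  rw [Fin.sum_univ_two, Finset.card_univ] at this
  have h0 := hclass 0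
  have h1 := hclass 1
  omega

/-- There is no vertex-critical `(P₃ ∪ K₁)`-free graph with these parameters. -/
lemma NoPathPlusVertex.false_of_critical [Fintype V] [DecidableRel G.Adj]
    (hG : NoPathPlusVertex G) (hm : ¬G.Colorable m)
    (hcrit : ∀ v, ∃ C : G.Coloring (Fin (m + 1)), IsSolo C v)
    {D w : ℕ} (hdeg : ∀ v, G.degree v ≤ D) (hw : G.CliqueFree (w + 1))
    (hwD : w + D = 2 * m) (hwD' : w ≤ D) (hD : 2 * D + 2 < 3 * w) (hD9 : 9 ≤ D) : False := by
  classical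
  have hα : NoIndepTriple G := fun u v t huv hut hvt => hG.not_indep_triple hm hcrit huv hut hvt
  have hV : Nonempty V := by
    by_contra h
    rw [not_nonempty_iff] at h
    exact hm (Colorable.of_isEmpty m)
  obtain ⟨v₀⟩ := hV
  obtain ⟨M, hM⟩ := hcrit v₀
  have hcard := M.card_add_card_isSolo hα hm
  set S := Finset.univ.filter (IsSolo M) with hS
  have hmemS {v} : v ∈ S ↔ IsSolo M v := by simp [hS]
  have hSpos : 0 < S.card := Finset.card_pos.2 ⟨v₀, hmemS.2 hM⟩
  have hSw : S.card ≤ w := by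
    by_contra! h
    refine hw.mono h S (⟨?_, rfl⟩)
    exact fun a ha b hb hab => M.adj_of_isSolo hm hab (hmemS.1 ha) (hmemS.1 hb)
  have hcompl (v) : Fintype.card V ≤ Gᶜ.degree v + D + 1 := by
    have := G.degree_compl v
    have := hdeg v
    have := G.degree_lt_card_verts v
    omega
  have hlink {s x} (hx : x ∈ Gᶜ.neighborFinset s) : G.Linked m s x := by
    rw [mem_neighborFinset, compl_adj] at hx
    exact linked_of_not_adj hm hx.2
  have hSlink {s s'} (hs : s ∈ S) (hs' : s' ∈ S) (h : G.Linked m s s') : s = s' := by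
    by_contra hne
    exact h M hne (hmemS.1 hs) (hmemS.1 hs')
  have hdisj : (S : Set V).PairwiseDisjoint fun s => Gᶜ.neighborFinset s := by
    intro s hs s' hs' hne
    refine Finset.disjoint_left.2 fun x hx hx' => hne (hSlink hs hs' ?_)
    exact Linked.trans hα hm hcrit (hlink hx) (hlink hx').symm
  set T := S.biUnion fun s => Gᶜ.neighborFinset s with hT
  have hTw : T.card ≤ w := by
    by_contra! h
    refine hw.mono h T (⟨?_, rfl⟩)
    intro a ha b hb hab
    by_contra hn
    obtain ⟨s, hs, has⟩ := Finset.mem_biUnion.1 ha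
    obtain ⟨s', hs', hbs⟩ := Finset.mem_biUnion.1 hb
    have : s = s' := hSlink hs hs' <| Linked.trans hα hm hcrit (hlink has) <|
      Linked.trans hα hm hcrit (linked_of_not_adj hm hn) (hlink hbs).symm
    subst this
    rw [mem_neighborFinset, compl_adj] at has hbs
    exact hα s a b has.1 hbs.1 hab has.2 hbs.2 hn
  have hST : Disjoint S T := by
    refine Finset.disjoint_left.2 fun x hx hxT => ?_
    obtain ⟨s, hs, hxs⟩ := Finset.mem_biUnion.1 hxT
    obtain rfl := hSlink hs hx (hlink hxs)
    simp at hxs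
  have hSTV : S.card + T.card ≤ Fintype.card V := by
    rw [← Finset.card_union_of_disjoint hST]
    exact Finset.card_le_univ _
  have hTcard : S.card * (w + 1 - S.card) ≤ T.card := by
    rw [hT, Finset.card_biUnion hdisj]
    rw [← smul_eq_mul]
    refine Finset.card_nsmul_le_sum _ _ _ fun s _ => ?_
    have := hcompl s
    rw [card_neighborFinset_eq_degree]
    omega
  rcases Nat.lt_or_ge 1 S.card with h1 | h1
  · rcases hSw.eq_or_lt with h2 | h2
    · rw [h2, Nat.add_sub_cancel_left] at hTcard
      omega
    · obtain ⟨e, he⟩ := Nat.exists_eq_add_of_lt h2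
      obtain ⟨j, hj⟩ := Nat.exists_eq_add_of_lt h1
      have : w + 1 - S.card = e + 2 := by omega
      rw [this, hj] at hTcard
      nlinarith [Nat.zero_le (e * j)]
  · have hlt (v) : 2 * Fintype.card V < 5 * Gᶜ.degree v := by
      have := hcompl v
      omega
    have := card_le_of_noIndepTriple_of_lt_degree_compl hα hw hlt
    omega

lemma NoPathPlusVertex.colorable [Fintype V] [DecidableRel G.Adj] (hG : NoPathPlusVertex G)
    {D w : ℕ} (hdeg : ∀ v, G.degree v ≤ D) (hw : G.CliqueFree (w + 1))
    (hwD : w + D = 2 * m) (hwD' : w ≤ D) (hD : 2 * D + 2 < 3 * w) (hD9 : 9 ≤ D) :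
    G.Colorable m := by
  classical
  by_contra hm
  obtain ⟨s, hs, hcrit⟩ := exists_critical_induce hm
  have hdeg' (v : s) : (G.induce s).degree v ≤ D :=
    ((Copy.induce G s).degree_le v).trans (hdeg v)
  exact (hG.induce s).false_of_critical hs hcrit hdeg'
    (hw.comap ⟨Copy.induce G s⟩) hwD hwD' hD hD9

/-- The greedy bound on the chromatic number. -/
lemma colorable_of_degree_lt [Fintype V] [DecidableRel G.Adj] (hdeg : ∀ v, G.degree v < m) :
    G.Colorable m := by
  classical
  by_contra hm
  obtain ⟨s, hs, hcrit⟩ := exists_critical_induce hm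
  have hV : Nonempty s := by
    by_contra h
    rw [not_nonempty_iff] at h
    exact hs (Colorable.of_isEmpty m)
  obtain ⟨v⟩ := hV
  obtain ⟨C, hC⟩ := hcrit v
  have hsub : (Finset.univ.erase (C v)) ⊆ ((G.induce s).neighborFinset v).image C := by
    intro i hi
    obtain ⟨x, hx, hxi⟩ := C.exists_adj_of_isSolo hs hC (Finset.ne_of_mem_erase hi)
    exact Finset.mem_image.2 ⟨x, by simpa using hx, hxi⟩
  have h1 := (Finset.card_le_card hsub).trans Finset.card_image_le
  rw [Finset.card_erase_of_mem (Finset.mem_univ _), Finset.card_univ, Fintype.card_fin,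
    card_neighborFinset_eq_degree] at h1
  have h2 := ((Copy.induce G s).degree_le v).trans_lt (hdeg v)
  omega

end SimpleGraph

/-- A minimal `(P₃ ∪ K₁)`-free counterexample `G` to Borodin–Kostochka (i.e. `Δ(G) ≥ 9`,
`χ(G) > max {ω(G), Δ(G) - 1}`, with the fewest vertices among all such graphs) satisfies
`ω(G) = Δ(G) - 1`. -/
theorem minimal_counterexample_P3_union_K1_free_cliqueNum {V : Type*} [Fintype V]
    (G : SimpleGraph V)
    (hfree : IndFree graphH G) (hΔ : 9 ≤ maxDeg G)
    (hχ : ((max G.cliqueNum (maxDeg G - 1) : ℕ) : ℕ∞) < G.chromaticNumber)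
    (hmin : ∀ (m : ℕ) (G' : SimpleGraph (Fin m)), IndFree graphH G' → 9 ≤ maxDeg G' →
      ((max G'.cliqueNum (maxDeg G' - 1) : ℕ) : ℕ∞) < G'.chromaticNumber →
      Fintype.card V ≤ m) :
    G.cliqueNum = maxDeg G - 1 := by
  classical
  have hG := noPathPlusVertex_of_indFree hfree
  have hdeg (v : V) : G.degree v ≤ maxDeg G := by
    have := G.degree_le_maxDegree v
    unfold maxDeg
    convert this
  have hcol {k : ℕ} (h : G.Colorable k) : G.cliqueNum < k ∧ maxDeg G - 1 < k := by
    have := hχ.trans_le h.chromaticNumber_le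
    exact max_lt_iff.1 (by exact_mod_cast this)
  have hclique {k : ℕ} (h : G.cliqueNum < k) : G.CliqueFree k := fun s hs =>
    absurd hs.isClique.card_le_cliqueNum (by rw [hs.card_eq]; omega)
  have h1 := (hcol (colorable_of_degree_lt fun v => Nat.lt_succ_of_le (hdeg v))).1
  have h2 := (hcol (hG.colorable (m := maxDeg G) hdeg (hclique h1) (by omega) le_rfl (by omega)
    hΔ)).1
  by_contra hne
  have h3 := hcol (hG.colorable (m := maxDeg G - 1) (w := maxDeg G - 2) hdeg
    (hclique (by omega)) (by omega) (by omega) (by omega) hΔ)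
  omega
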